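/- A quantum channel Φ from H to K satisfies Φ(ρ) = UρU* for some linear isometry U : H → K if and only if the Choi matrix C(Φ) has rank 1. -/

import Mathlib

open Matrix BigOperators Kronecker
open scoped ComplexOrder

/-- The map Φ ⊗ id acting on block matrices: apply Φ to the first tensor factor. -/
def tensorMapId {m k n : Type*}
    (Φ : Matrix m m ℂ → Matrix k k ℂ)
    (M : Matrix (m × n) (m × n) ℂ) : Matrix (k × n) (k × n) ℂ :=
  Matrix.of fun p q => Φ (Matrix.of fun a b => M (a, p.2) (b, q.2)) p.1 q.1

/-- Complete positivity of a map on matrices. -/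
def IsCompletelyPositive {m k : Type*} [Fintype m] [Fintype k]
    (Φ : Matrix m m ℂ → Matrix k k ℂ) : Prop :=
  ∀ (n : ℕ) (M : Matrix (m × Fin n) (m × Fin n) ℂ),
    M.PosSemidef → (tensorMapId Φ M).PosSemidef

/-- The maximally entangled state |φ⁺⟩⟨φ⁺| on H ⊗ H, where |φ⁺⟩ = (1/√d) Σᵢ |ii⟩. -/
noncomputable def maxEnt (d : ℕ) : Matrix (Fin d × Fin d) (Fin d × Fin d) ℂ :=
  Matrix.of fun p q => if p.1 = p.2 ∧ q.1 = q.2 then (1 / d : ℂ) else 0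

theorem choi_apply {d k : ℕ}
    (Φ : Matrix (Fin d) (Fin d) ℂ →ₗ[ℂ] Matrix (Fin k) (Fin k) ℂ)
    (a b : Fin k) (i j : Fin d) :
    tensorMapId (⇑Φ) (maxEnt d) (a, i) (b, j) = (1 / d : ℂ) * Φ (Matrix.single i j 1) a b := by
  have h : (Matrix.of fun a b => maxEnt d (a, i) (b, j)) =
      (1 / d : ℂ) • (Matrix.single i j 1 : Matrix (Fin d) (Fin d) ℂ) := by
    ext x y
    simp [maxEnt, Matrix.single_apply, eq_comm]
  simp only [tensorMapId, Matrix.of_apply]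
  rw [h, map_smul]
  simp

theorem maxEnt_posSemidef (d : ℕ) : (maxEnt d).PosSemidef := by
  have h : maxEnt d = (1 / d : ℂ) • vecMulVec (fun p : Fin d × Fin d => if p.1 = p.2 then (1 : ℂ) else 0)
      (star (fun p : Fin d × Fin d => if p.1 = p.2 then (1 : ℂ) else 0)) := by
    ext p q
    by_cases h1 : p.1 = p.2 <;> by_cases h2 : q.1 = q.2 <;>
      simp [maxEnt, vecMulVec_apply, h1, h2]
  rw [h]
  refine (posSemidef_vecMulVec_self_star _).smul ?_
  have : (0 : ℂ) ≤ (d : ℂ) := by exact_mod_cast Nat.zero_le d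
  simpa using this

theorem choi_trace {d k : ℕ} (hd : 0 < d)
    (Φ : Matrix (Fin d) (Fin d) ℂ →ₗ[ℂ] Matrix (Fin k) (Fin k) ℂ)
    (hTP : ∀ X : Matrix (Fin d) (Fin d) ℂ, (Φ X).trace = X.trace) :
    (tensorMapId (⇑Φ) (maxEnt d)).trace = 1 := by
  have hd' : (d : ℂ) ≠ 0 := by exact_mod_cast hd.ne'
  have h : ∀ i : Fin d, ∑ a, Φ (Matrix.single i i 1) a a = 1 := by
    intro i
    have := hTP (Matrix.single i i 1)
    simpa [Matrix.trace] using this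
  rw [Matrix.trace, Fintype.sum_prod_type_right]
  simp only [Matrix.diag_apply, choi_apply, ← Finset.mul_sum, h]
  simp [hd']

theorem rank_one_minor {n : Type*} [Fintype n] (C : Matrix n n ℂ) (h : C.rank = 1) (x y p : n) :
    C x y * C p p = C x p * C p y := by
  rw [Matrix.rank_eq_finrank_span_cols, finrank_eq_one_iff'] at h
  obtain ⟨v, -, hv⟩ := h
  have key : ∀ j, ∃ c : ℂ, ∀ i, C i j = c * v.1 i := by
    intro j
    obtain ⟨c, hc⟩ := hv ⟨C.col j, Submodule.subset_span ⟨j, rfl⟩⟩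
    refine ⟨c, fun i => ?_⟩
    have := congrFun (congrArg Subtype.val hc) i
    simpa using this.symm
  obtain ⟨c1, h1⟩ := key y
  obtain ⟨c2, h2⟩ := key p
  rw [h1, h1, h2, h2]
  ring

theorem posSemidef_rank_one {n : Type*} [Fintype n] (C : Matrix n n ℂ) (hC : C.PosSemidef)
    (h : C.rank = 1) (ht : C.trace = 1) : ∃ v : n → ℂ, ∀ x y, C x y = v x * star (v y) := by
  obtain ⟨p, hp⟩ : ∃ p, C p p ≠ 0 := by
    by_contra! hn
    simp [Matrix.trace, hn] at ht
  have h0 : 0 ≤ C p p := hC.diag_nonneg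
  obtain ⟨hr, hi⟩ := Complex.nonneg_iff.mp h0
  have hc : C p p = ((C p p).re : ℂ) := by
    apply Complex.ext <;> simp [← hi]
  have hs : ((√(C p p).re : ℝ) : ℂ) * ((√(C p p).re : ℝ) : ℂ) = C p p := by
    rw [← Complex.ofReal_mul, Real.mul_self_sqrt hr, ← hc]
  have hs0 : ((√(C p p).re : ℝ) : ℂ) ≠ 0 := by
    intro h; rw [h] at hs; simp at hs; exact hp hs.symm
  refine ⟨fun x => C x p / ((√(C p p).re : ℝ) : ℂ), fun x y => ?_⟩
  have hm := rank_one_minor C h x y p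
  have hst : star (C y p) = C p y := hC.1.apply p y
  simp only [star_div₀, hst]
  rw [show star ((√(C p p).re : ℝ) : ℂ) = ((√(C p p).re : ℝ) : ℂ) from Complex.conj_ofReal _]
  rw [div_mul_div_comm, hs, ← hm]
  field_simp

/-- A quantum channel Φ is conjugation by an isometry iff its Choi matrix
C(Φ) = (Φ ⊗ id)(|φ⁺⟩⟨φ⁺|) has rank 1. -/
theorem isometry_iff_choi_rank_one {d k : ℕ} (hd : 0 < d)
    (Φ : Matrix (Fin d) (Fin d) ℂ →ₗ[ℂ] Matrix (Fin k) (Fin k) ℂ)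
    (hCP : IsCompletelyPositive ⇑Φ)
    (hTP : ∀ X : Matrix (Fin d) (Fin d) ℂ, (Φ X).trace = X.trace) :
    (∃ U : Matrix (Fin k) (Fin d) ℂ, Uᴴ * U = 1 ∧
        ∀ ρ : Matrix (Fin d) (Fin d) ℂ, Φ ρ = U * ρ * Uᴴ) ↔
      (tensorMapId ⇑Φ (maxEnt d)).rank = 1 := by
  have hd' : (d : ℂ) ≠ 0 := by exact_mod_cast hd.ne'
  have htr := choi_trace hd Φ hTP
  constructor
  · rintro ⟨U, -, hU⟩
    have hC : tensorMapId (⇑Φ) (maxEnt d) =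
        vecMulVec (fun p : Fin k × Fin d => (1 / d : ℂ) * U p.1 p.2)
          (fun p : Fin k × Fin d => star (U p.1 p.2)) := by
      ext ⟨a, i⟩ ⟨b, j⟩
      rw [choi_apply, hU, vecMulVec_apply]
      simp [Matrix.mul_apply, Matrix.single_apply, ite_and]
      try ring
    have h1 : (tensorMapId (⇑Φ) (maxEnt d)).rank ≤ 1 := by
      rw [hC]; exact rank_vecMulVec_le _ _
    have h2 : (tensorMapId (⇑Φ) (maxEnt d)).rank ≠ 0 := by
      intro h
      rw [Matrix.rank_eq_finrank_span_cols, Submodule.finrank_eq_zero, Submodule.span_eq_bot] at h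
      have h0 : tensorMapId (⇑Φ) (maxEnt d) = 0 := by
        ext x y
        exact congrFun (h _ ⟨y, rfl⟩) x
      rw [h0] at htr
      simp at htr
    omega
  · intro hr
    obtain ⟨v, hv⟩ := posSemidef_rank_one _ (hCP d _ (maxEnt_posSemidef d)) hr htr
    have hs : ((√(d : ℝ) : ℝ) : ℂ) * ((√(d : ℝ) : ℝ) : ℂ) = d := by
      rw [← Complex.ofReal_mul, Real.mul_self_sqrt (Nat.cast_nonneg d)]; simp
    have hE : ∀ i j a b, Φ (Matrix.single i j 1) a b =
        (((√(d : ℝ) : ℝ) : ℂ) * v (a, i)) * star (((√(d : ℝ) : ℝ) : ℂ) * v (b, j)) := by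
      intro i j a b
      have h := hv (a, i) (b, j)
      rw [choi_apply] at h
      have hc : star ((√(d : ℝ) : ℝ) : ℂ) = ((√(d : ℝ) : ℝ) : ℂ) := Complex.conj_ofReal _
      rw [star_mul', hc, mul_mul_mul_comm, hs, ← h]
      field_simp
    let U : Matrix (Fin k) (Fin d) ℂ := Matrix.of fun a i => ((√(d : ℝ) : ℝ) : ℂ) * v (a, i)
    have hE' : ∀ i j a b, Φ (Matrix.single i j 1) a b = U a i * star (U b j) := hE
    clear_value U
    refine ⟨U, ?_, fun ρ => ?_⟩
    · ext j i
      have h := hTP (Matrix.single i j 1)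
      simp only [Matrix.trace, Matrix.diag_apply, hE'] at h
      rw [Matrix.mul_apply]
      simp only [Matrix.conjTranspose_apply]
      simp_rw [mul_comm (star _)]
      rw [h]
      simp [Matrix.single_apply, Matrix.one_apply, ite_and, eq_comm]
    · ext a b
      conv_lhs => rw [Matrix.matrix_eq_sum_single ρ]
      have hsm : ∀ i j, Matrix.single i j (ρ i j) = ρ i j • Matrix.single i j (1 : ℂ) := by
        intro i j; simp
      simp only [hsm, map_sum, map_smul, Matrix.sum_apply, Matrix.smul_apply, hE', smul_eq_mul,
        Matrix.mul_apply, Matrix.conjTranspose_apply, Finset.sum_mul]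
      rw [Finset.sum_comm]
      refine Finset.sum_congr rfl fun j _ => Finset.sum_congr rfl fun i _ => ?_
      ring
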